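/- Let G₁, …, G_r be finite groups with generating sets S₁, …, S_r, let m₁, …, m_r be positive integers, let G = G₁^{⋆m₁} ⋆ ⋯ ⋆ G_r^{⋆m_r} be the free product of m₁ copies of G₁, …, m_r copies of G_r, and let S ⊆ G be the union of the images of the S_i under the canonical inclusions of all the copies. Then the cogrowth series F = F_{G;S}(t) is algebraic: there exists a nonzero bivariate polynomial Λ(t,z) ∈ ℚ[t,z] with Λ(t, F(t)) = 0 as a formal power series, and with deg_t(Λ) ≤ (∏_{i=1}^r |G_i|)·(1 + Σ_{i=1}^r 1/|G_i|) and deg_z(Λ) ≤ (∏_{i=1}^r |G_i|)·(1 + Σ_{i=1}^r 1/|G_i|). In particular these degree bounds do not depend on m₁, …, m_r. -/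

import Mathlib

/-- `CL S n` is the number of words of length `n` over the alphabet `S` whose
product equals the identity of the group. -/
noncomputable def CL {G : Type*} [Group G] (S : Set G) (n : ℕ) : ℕ :=
  Nat.card {w : Fin n → G // (∀ i, w i ∈ S) ∧ (List.ofFn w).prod = 1}

/-- The cogrowth series `F_{G;S}(t) ∈ ℚ[[t]]`. -/
noncomputable def cogrowthSeries {G : Type*} [Group G] (S : Set G) : PowerSeries ℚ :=
  PowerSeries.mk fun n => (CL S n : ℚ)

open PowerSeries in
/-- A system `xᵢ = aᵢ + t Pᵢ(x)` over formal power series, with `P` compatible with congruences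
modulo powers of `t`, has a solution. -/
theorem PowerSeries.exists_eq_add_X_mul {R ι : Type*} [CommRing R] (a : ι → PowerSeries R)
    (P : (ι → PowerSeries R) → ι → PowerSeries R)
    (hP : ∀ n x y, (∀ i, (X : PowerSeries R) ^ n ∣ x i - y i) →
      ∀ i, (X : PowerSeries R) ^ n ∣ P x i - P y i) :
    ∃ x : ι → PowerSeries R, ∀ i, x i = a i + X * P x i := by
  let q : ℕ → ι → PowerSeries R := fun n => Nat.rec 0 (fun _ x i => a i + X * P x i) n
  have q_succ (n : ℕ) (i : ι) : q (n + 1) i = a i + X * P (q n) i := rfl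
  have step (n : ℕ) : ∀ i, (X : PowerSeries R) ^ n ∣ q (n + 1) i - q n i := by
    induction n with
    | zero => simp
    | succ n ih =>
      intro i
      rw [q_succ (n + 1), q_succ n, add_sub_add_left_eq_sub, ← mul_sub, pow_succ']
      exact mul_dvd_mul_left _ (hP n _ _ ih i)
  have tail (n k : ℕ) (i : ι) : (X : PowerSeries R) ^ n ∣ q (n + k) i - q n i := by
    induction k with
    | zero => simp
    | succ k ih =>
      have := dvd_add ((pow_dvd_pow X (Nat.le_add_right n k)).trans (step (n + k) i)) ih
      rwa [sub_add_sub_cancel] at this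
  let x : ι → PowerSeries R := fun i => mk fun n => coeff n (q (n + 1) i)
  have approx (n : ℕ) (i : ι) : (X : PowerSeries R) ^ n ∣ x i - q n i := by
    rw [X_pow_dvd_iff]
    intro k hk
    obtain ⟨d, rfl⟩ := Nat.exists_eq_add_of_lt hk
    have := X_pow_dvd_iff.1 (tail (k + 1) d i) k k.lt_succ_self
    rw [map_sub, sub_eq_zero, show k + 1 + d = k + d + 1 by ring] at this
    rw [map_sub, this]
    simp [x]
  refine ⟨x, fun i => sub_eq_zero.1 ?_⟩
  ext n
  refine X_pow_dvd_iff.1 (?_ : X ^ (n + 1) ∣ _) n n.lt_succ_self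
  have h : (X : PowerSeries R) ^ (n + 1) ∣ X * (P x i - P (q n) i) := by
    rw [pow_succ']
    exact mul_dvd_mul_left _ (hP n _ _ (approx n) i)
  convert dvd_sub (approx (n + 1) i) h using 1
  rw [q_succ]
  ring

section WordCount

variable {G : Type*} [Group G]

/-- The number of words of length `n` over `S` with product `x`. -/
noncomputable def wordCount (S : Set G) (n : ℕ) (x : G) : ℕ :=
  Nat.card {w : Fin n → G // (∀ i, w i ∈ S) ∧ (List.ofFn w).prod = x}

theorem wordCount_zero [DecidableEq G] (S : Set G) (x : G) :
    wordCount S 0 x = if x = 1 then 1 else 0 := by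
  unfold wordCount
  split_ifs with h
  · subst h
    rw [Nat.card_eq_one_iff_unique]
    exact ⟨⟨fun a b => Subtype.ext (Subsingleton.elim _ _)⟩, ⟨⟨Fin.elim0, by simp⟩⟩⟩
  · rw [Nat.card_eq_zero]
    left
    refine ⟨fun w => h ?_⟩
    simpa using w.2.2.symm

/-- Splitting a word into its first letter and the remaining word. -/
def wordSuccEquiv (S : Set G) (n : ℕ) (x : G) :
    {w : Fin (n + 1) → G // (∀ i, w i ∈ S) ∧ (List.ofFn w).prod = x} ≃
      Σ s : S, {w : Fin n → G // (∀ i, w i ∈ S) ∧ (List.ofFn w).prod = (s : G)⁻¹ * x} where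
  toFun w := ⟨⟨w.1 0, w.2.1 0⟩, ⟨fun i => w.1 i.succ, fun i => w.2.1 _, by
    have := w.2.2
    rw [List.ofFn_succ, List.prod_cons] at this
    exact eq_inv_mul_of_mul_eq this⟩⟩
  invFun p := ⟨Fin.cons p.1.1 p.2.1, by
    refine ⟨fun i => Fin.cases p.1.2 p.2.2.1 i, ?_⟩
    rw [List.ofFn_succ, List.prod_cons]
    simp [p.2.2.2]⟩
  left_inv w := Subtype.ext (Fin.cons_self_tail w.1)
  right_inv p := rfl

theorem wordCount_succ (S : Finset G) (n : ℕ) (x : G) :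
    wordCount (S : Set G) (n + 1) x = ∑ s ∈ S, wordCount (S : Set G) n (s⁻¹ * x) := by
  have (y : G) : Finite {w : Fin n → G // (∀ i, w i ∈ (S : Set G)) ∧ (List.ofFn w).prod = y} :=
    Finite.of_injective (β := Fin n → S) (fun w i => ⟨w.1 i, w.2.1 i⟩) fun v w h => by
      ext i
      simpa using congrArg Subtype.val (congrFun h i)
  unfold wordCount
  rw [Nat.card_congr (wordSuccEquiv _ n x), Nat.card_sigma]
  exact Finset.sum_coe_sort S fun s => Nat.card
    {w : Fin n → G // (∀ i, w i ∈ (S : Set G)) ∧ (List.ofFn w).prod = s⁻¹ * x}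

open PowerSeries in
/-- The resolvent equation of the sum of the letters determines its solution. -/
theorem eq_mul_wordCount_series [DecidableEq G] (S : Finset G) (u : PowerSeries ℚ)
    (f : G → PowerSeries ℚ)
    (hf : ∀ x, f x = (if x = 1 then u else 0) + X * ∑ s ∈ S, f (s⁻¹ * x)) (x : G) :
    f x = u * mk fun n => (wordCount (S : Set G) n x : ℚ) := by
  let C : G → PowerSeries ℚ := fun x => mk fun n => (wordCount (S : Set G) n x : ℚ)
  have hC (x : G) : C x = (if x = 1 then 1 else 0) + X * ∑ s ∈ S, C (s⁻¹ * x) := by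
    ext n
    cases n with
    | zero =>
      simp only [C, coeff_mk, wordCount_zero, map_add, coeff_zero_X_mul, add_zero]
      split_ifs <;> simp
    | succ n =>
      rw [map_add, coeff_succ_X_mul, map_sum]
      simp only [C, coeff_mk, wordCount_succ]
      split_ifs <;> simp [coeff_one]
  suffices ∀ n x, coeff n (f x - u * C x) = 0 from
    sub_eq_zero.1 (PowerSeries.ext fun n => by rw [this, map_zero])
  have key (x : G) : f x - u * C x = X * ∑ s ∈ S, (f (s⁻¹ * x) - u * C (s⁻¹ * x)) := by
    rw [Finset.sum_sub_distrib, ← Finset.mul_sum]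
    conv_lhs => rw [hf, hC]
    split_ifs <;> ring
  intro n
  induction n with
  | zero => intro x; rw [key, coeff_zero_X_mul]
  | succ n ih =>
    intro x
    rw [key, coeff_succ_X_mul, map_sum]
    exact Finset.sum_eq_zero fun s _ => ih _

end WordCount

namespace Monoid.CoprodI

variable {ι : Type*} {M : ι → Type*} [∀ i, Group (M i)]

theorem of_eq_of_iff {i j : ι} {a : M i} {b : M j} (ha : a ≠ 1) :
    (of a : CoprodI M) = of b ↔ (⟨i, a⟩ : Σ i, M i) = ⟨j, b⟩ := by
  classical
  refine ⟨fun h => ?_, fun h => by cases h; rfl⟩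
  obtain rfl | hij := eq_or_ne i j
  · rw [of_injective _ h]
  · have := congrArg (lift (Pi.mulSingle i (MonoidHom.id (M i)))) h
    simp [lift_of, Pi.mulSingle_eq_of_ne hij.symm] at this
    exact absurd this ha

/-- The multiplicative extension of functions on the factors to reduced words. -/
def Word.mulExt {R : Type*} [CommRing R] (φ : ∀ i, M i → R) (w : Word M) : R :=
  (w.toList.map fun l => φ l.1 l.2).prod

section

variable {R : Type*} [CommRing R] [∀ i, DecidableEq (M i)] {φ : ∀ i, M i → R}

theorem Word.mulExt_rcons (hφ : ∀ i, φ i 1 = 1) {i : ι} (p : Word.Pair M i) :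
    Word.mulExt φ (Word.rcons p) = φ i p.head * Word.mulExt φ p.tail := by
  unfold Word.rcons
  split_ifs with h
  · rw [h, hφ, one_mul]
  · simp [Word.mulExt, Word.cons]

theorem Word.fstIdx_rcons_eq_some_iff {i : ι} (p : Word.Pair M i) :
    (Word.rcons p).fstIdx = some i ↔ p.head ≠ 1 := by
  unfold Word.rcons
  split_ifs with h
  · simp [h, p.fstIdx_ne]
  · simp [h]

variable [DecidableEq ι]

theorem Word.mulExt_of_smul_rcons (hφ : ∀ i, φ i 1 = 1) {i : ι} (p : Word.Pair M i) (g : M i) :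
    Word.mulExt φ ((of g : CoprodI M) • Word.rcons p) =
      φ i (g * p.head) * Word.mulExt φ p.tail := by
  have h : Word.equivPair i (Word.rcons p) = p := (Word.equivPair i).apply_symm_apply p
  rw [Word.of_smul_def, Word.mulExt_rcons hφ, h]

theorem Word.mul_sum_mulExt_smul (hφ : ∀ i, φ i 1 = 1) (u t : R) (V : ι → R)
    (T : ∀ i, Finset (M i))
    (h : ∀ i g, (u + V i) * φ i g = (if g = 1 then u else 0) + t * ∑ s ∈ T i, φ i (s⁻¹ * g))
    (i : ι) (w : Word M) :
    t * ∑ s ∈ T i, Word.mulExt φ ((of s : CoprodI M)⁻¹ • w) =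
      V i * Word.mulExt φ w + if w.fstIdx = some i then u * Word.mulExt φ w else 0 := by
  obtain ⟨p, rfl⟩ := (Word.equivPair i).symm.surjective w
  simp only [Word.equivPair_symm, ← map_inv, Word.mulExt_of_smul_rcons hφ,
    Word.fstIdx_rcons_eq_some_iff, Word.mulExt_rcons hφ]
  rw [← Finset.sum_mul, ← mul_assoc, ← sub_eq_iff_eq_add'.2 (h i p.head)]
  by_cases h1 : p.head = 1
  · simp [h1, hφ]
  · simp [h1]; ring

/-- The Green function of a free product is multiplicative along reduced words. -/
theorem mulExt_resolvent [Fintype ι] (hφ : ∀ i, φ i 1 = 1) (u t c : R) (V : ι → R)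
    (T : ∀ i, Finset (M i))
    (h : ∀ i g, (u + V i) * φ i g = (if g = 1 then u else 0) + t * ∑ s ∈ T i, φ i (s⁻¹ * g))
    (hu : u = 1 - c - ∑ i, V i) (w : Word M) :
    (1 - c) * Word.mulExt φ w = (if w.fstIdx = none then u else 0) +
      t * ∑ i, ∑ s ∈ T i, Word.mulExt φ ((of s : CoprodI M)⁻¹ • w) := by
  rw [Finset.mul_sum]
  simp only [Word.mul_sum_mulExt_smul hφ u t V T h,
    Finset.sum_add_distrib, ← Finset.sum_mul]
  cases hw : w.fstIdx with
  | none =>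
    have : Word.mulExt φ w = 1 := by
      have : w.toList = [] := by simpa [Word.fstIdx] using hw
      simp [Word.mulExt, this]
    simp [this, hu]
  | some j =>
    simp [hu]; ring

end

end Monoid.CoprodI

open PowerSeries in
/-- The normalised Green functions of the factors exist. -/
theorem exists_factor_green {κ : Type*} [Fintype κ] {M : κ → Type*} [∀ i, Group (M i)]
    [∀ i, DecidableEq (M i)] (T : ∀ i, Finset (M i)) (m : κ → ℕ) (ε : ℚ) :
    ∃ (u : PowerSeries ℚ) (V : κ → PowerSeries ℚ) (φ : ∀ i, M i → PowerSeries ℚ),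
      (∀ i, φ i 1 = 1) ∧ u = 1 - X * C ε - ∑ i, (m i : PowerSeries ℚ) * V i ∧
      ∀ i g, (u + V i) * φ i g = (if g = 1 then u else 0) + X * ∑ s ∈ T i, φ i (s⁻¹ * g) := by
  let W : ((Σ i, M i) → PowerSeries ℚ) → κ → PowerSeries ℚ :=
    fun y i => ∑ s ∈ T i, y ⟨i, s⁻¹⟩
  let P : ((Σ i, M i) → PowerSeries ℚ) → (Σ i, M i) → PowerSeries ℚ := fun y p =>
    if p.2 = 1 then 0 else ∑ s ∈ T p.1, y ⟨p.1, s⁻¹ * p.2⟩ +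
      (C ε + ∑ j, (m j : PowerSeries ℚ) * W y j - W y p.1) * y p
  obtain ⟨y, hy⟩ := exists_eq_add_X_mul (fun p : Σ i, M i => if p.2 = 1 then 1 else 0) P (by
    intro n x y h p
    rw [← Ideal.mem_span_singleton, ← Ideal.Quotient.mk_eq_mk_iff_sub_mem]
    have h' (i : Σ i, M i) : Ideal.Quotient.mk (Ideal.span {(X : PowerSeries ℚ) ^ n}) (x i) =
        Ideal.Quotient.mk (Ideal.span {(X : PowerSeries ℚ) ^ n}) (y i) := by
      rw [Ideal.Quotient.mk_eq_mk_iff_sub_mem, Ideal.mem_span_singleton]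
      exact h i
    simp only [P, W]
    split_ifs
    · rfl
    · simp only [map_sum, map_mul, map_add, map_sub, h'])
  have hy1 (i : κ) : y ⟨i, 1⟩ = 1 := by
    rw [hy]
    simp [P]
  refine ⟨_, fun i => X * W y i, fun i g => y ⟨i, g⟩, hy1, rfl, fun i g => ?_⟩
  by_cases hg : g = 1
  · subst hg
    simp [W, hy1]
  · have := hy ⟨i, g⟩
    simp only [P, if_neg hg, zero_add] at this ⊢
    have h2 : ∑ j, (m j : PowerSeries ℚ) * (X * W y j) =
        X * ∑ j, (m j : PowerSeries ℚ) * W y j := by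
      rw [Finset.mul_sum]
      exact Finset.sum_congr rfl fun _ _ => by ring
    rw [h2]
    linear_combination this

namespace Matrix

variable {n : Type*} [Fintype n] [DecidableEq n]

open MvPolynomial

/-- The determinant of `A + z - t z B` as a polynomial in `t` and `z`. -/
noncomputable def detPencil (A B : Matrix n n ℚ) : MvPolynomial (Fin 2) ℚ :=
  (Matrix.of fun i j => C (A i j) + X 1 * C ((1 : Matrix n n ℚ) i j)
    - X 0 * X 1 * C (B i j)).det

theorem detPencil_ne_zero (A B : Matrix n n ℚ) : detPencil A B ≠ 0 := by
  intro h
  apply (Matrix.charpoly_monic (-A)).ne_zero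
  have := congrArg (aeval ![(0 : Polynomial ℚ), Polynomial.X]) h
  rw [detPencil, AlgHom.map_det, map_zero] at this
  rw [Matrix.charpoly, ← this]
  congr 1
  ext1 i j
  by_cases hij : i = j
  · subst hij
    simp [add_comm]
  · simp [hij, Matrix.charmatrix_apply_ne]

theorem degreeOf_detPencil_le (A B : Matrix n n ℚ) (k : Fin 2) :
    (detPencil A B).degreeOf k ≤ Fintype.card n := by
  rw [detPencil, det_apply]
  refine (degreeOf_sum_le _ _ _).trans (Finset.sup_le fun σ _ => ?_)
  have h (a b c : ℚ) : degreeOf k (C a + X 1 * C b - X 0 * X 1 * C c) ≤ 1 := by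
    have h0 : degreeOf k (X 0 * X 1 : MvPolynomial (Fin 2) ℚ) ≤ 1 := by
      refine (degreeOf_mul_le _ _ _).trans ?_
      rw [degreeOf_X, degreeOf_X]
      fin_cases k <;> simp
    have h1 : degreeOf k (X 1 : MvPolynomial (Fin 2) ℚ) ≤ 1 := by
      rw [degreeOf_X]
      split_ifs <;> simp
    refine (degreeOf_sub_le _ _ _).trans (max_le ((degreeOf_add_le _ _ _).trans (max_le ?_ ?_)) ?_)
    · simp
    · rw [mul_comm]
      exact (degreeOf_C_mul_le _ _ _).trans h1
    · rw [mul_comm]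
      exact (degreeOf_C_mul_le _ _ _).trans h0
  rw [Units.smul_def, zsmul_eq_mul, ← map_intCast (C : ℚ →+* MvPolynomial (Fin 2) ℚ)]
  refine (degreeOf_C_mul_le _ _ _).trans ((degreeOf_prod_le _ _ _).trans ?_)
  refine (Finset.sum_le_sum fun i _ => h _ _ _).trans ?_
  simp

theorem aeval_detPencil_eq_zero {R : Type*} [CommRing R] [IsDomain R] [Algebra ℚ R]
    (A B : Matrix n n ℚ) (t z : R) (v : n → R) (hv : v ≠ 0)
    (h : ∀ i, ∑ j, algebraMap ℚ R (A i j) * v j + z * v i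
      - t * z * ∑ j, algebraMap ℚ R (B i j) * v j = 0) :
    aeval ![t, z] (detPencil A B) = 0 := by
  rw [detPencil, AlgHom.map_det]
  refine Matrix.exists_mulVec_eq_zero_iff.1 ⟨v, hv, funext fun i => ?_⟩
  rw [Pi.zero_apply, ← h i]
  simp [Matrix.mulVec, dotProduct, add_mul, sub_mul, Finset.sum_add_distrib, Finset.mul_sum,
    Matrix.one_apply, mul_assoc, apply_ite (aeval ![t, z])]

end Matrix

theorem Monoid.CoprodI.sum_letters {ι : Type*} [Fintype ι] {M : ι → Type*} [∀ i, Group (M i)]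
    [DecidableEq (Monoid.CoprodI M)] {N : Type*} [AddCommMonoid N]
    (S : Finset (Monoid.CoprodI M)) (T : ∀ i, Finset (M i)) (hT : ∀ i, 1 ∉ T i)
    (h : S.erase 1 = (Finset.univ.sigma T).image fun l => of l.2) (f : Monoid.CoprodI M → N) :
    ∑ s ∈ S, f s = (if 1 ∈ S then f 1 else 0) + ∑ i, ∑ s ∈ T i, f (of s) := by
  have key : ∑ s ∈ S.erase 1, f s = ∑ i, ∑ s ∈ T i, f (of s) := by
    rw [h, Finset.sum_image, Finset.sum_sigma]
    rintro ⟨i, a⟩ ha ⟨j, b⟩ - hab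
    refine (of_eq_of_iff ?_).1 hab
    rintro rfl
    simp [hT] at ha
  rw [← key]
  split_ifs with h1
  · exact (Finset.add_sum_erase S f h1).symm
  · rw [Finset.erase_eq_of_notMem h1, zero_add]

open PowerSeries in
/-- The cogrowth series of a free product is the inverse of `u`, the constant in the equations
of the normalised Green functions of the factors. -/
theorem Monoid.CoprodI.mul_cogrowthSeries_eq_one {ι : Type*} [Fintype ι] {M : ι → Type*}
    [∀ i, Group (M i)] [∀ i, DecidableEq (M i)] [DecidableEq (Monoid.CoprodI M)]
    (S : Finset (Monoid.CoprodI M)) (T : ∀ i, Finset (M i)) (hT : ∀ i, 1 ∉ T i)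
    (hS : S.erase 1 = (Finset.univ.sigma T).image fun l => of l.2)
    {u : PowerSeries ℚ} {V : ι → PowerSeries ℚ} {φ : ∀ i, M i → PowerSeries ℚ}
    (hφ : ∀ i, φ i 1 = 1) (hu : u = 1 - X * C (if 1 ∈ S then 1 else 0) - ∑ i, V i)
    (h : ∀ i g, (u + V i) * φ i g = (if g = 1 then u else 0) + X * ∑ s ∈ T i, φ i (s⁻¹ * g)) :
    u * cogrowthSeries (S : Set (Monoid.CoprodI M)) = 1 := by
  classical
  have hfst (x : Monoid.CoprodI M) : (x • (Word.empty : Word M)).fstIdx = none ↔ x = 1 := by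
    refine ⟨fun hx => ?_, fun hx => by simp [hx, Word.fstIdx]⟩
    have h0 : x • (Word.empty : Word M) = Word.empty := Word.ext (by simpa [Word.fstIdx] using hx)
    simpa [h0] using (Word.prod_smul x (Word.empty : Word M)).symm
  have key := eq_mul_wordCount_series S u
    (fun x => Word.mulExt φ (x • (Word.empty : Word M))) (fun x => by
      have := mulExt_resolvent hφ u X _ V T h hu (x • (Word.empty : Word M))
      simp only [hfst] at this
      rw [sum_letters S T hT hS]
      simp only [mul_smul, inv_one, one_smul]
      split_ifs at this ⊢ <;> simp only [map_one, map_zero] at this ⊢ <;>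
        linear_combination this) 1
  change u * PowerSeries.mk (fun n => (wordCount (S : Set (Monoid.CoprodI M)) n 1 : ℚ)) = 1
  simpa [Word.mulExt] using key.symm

section FactorPencil

variable {κ : Type*} [Fintype κ] [DecidableEq κ] {M : κ → Type*} [∀ i, Group (M i)]
  [∀ i, Fintype (M i)] [∀ i, DecidableEq (M i)]

/-- The part of the pencil of a family of groups that is constant in `t` and `z`. -/
def factorPencilConst (M : κ → Type*) [∀ i, Group (M i)] [∀ i, DecidableEq (M i)] (m : κ → ℕ) :
    Matrix (∀ i, M i) (∀ i, M i) ℚ :=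
  Matrix.of fun g h =>
    if g = h then -1 + ∑ i, (m i : ℚ) * (1 - if g i = 1 then 1 else 0) else 0

/-- The part of the pencil of a family of groups recording multiplication by the letters. -/
def factorPencilLetters (T : ∀ i, Finset (M i)) (m : κ → ℕ) (ε : ℚ) :
    Matrix (∀ i, M i) (∀ i, M i) ℚ :=
  Matrix.of fun g h => (if g = h then ε else 0) +
    ∑ i, (m i : ℚ) * ∑ s ∈ T i, if Function.update g i (s⁻¹ * g i) = h then 1 else 0

open PowerSeries in
theorem aeval_detPencil_factorPencil (T : ∀ i, Finset (M i)) (m : κ → ℕ) (ε : ℚ)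
    {u F : PowerSeries ℚ} {V : κ → PowerSeries ℚ} {φ : ∀ i, M i → PowerSeries ℚ}
    (hφ : ∀ i, φ i 1 = 1) (hu : u = 1 - X * C ε - ∑ i, (m i : PowerSeries ℚ) * V i)
    (h : ∀ i g, (u + V i) * φ i g = (if g = 1 then u else 0) + X * ∑ s ∈ T i, φ i (s⁻¹ * g))
    (hF : u * F = 1) :
    MvPolynomial.aeval ![X, F]
      (Matrix.detPencil (factorPencilConst M m) (factorPencilLetters T m ε)) = 0 := by
  refine Matrix.aeval_detPencil_eq_zero _ _ _ _ (fun g => ∏ i, φ i (g i))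
    (fun h0 => by simpa [hφ] using congrFun h0 1) fun g => ?_
  have hstep (i : κ) : X * F * ∑ s ∈ T i, ∏ j, φ j (Function.update g i (s⁻¹ * g i) j) =
      (1 + F * V i - if g i = 1 then 1 else 0) * ∏ j, φ j (g j) := by
    have hup (a : M i) : ∏ j, φ j (Function.update g i a j) =
        φ i a * ∏ j ∈ Finset.univ.erase i, φ j (g j) := by
      rw [← Finset.mul_prod_erase _ _ (Finset.mem_univ i), Function.update_self]
      congr 1
      refine Finset.prod_congr rfl fun j hj => ?_
      rw [Function.update_of_ne (Finset.ne_of_mem_erase hj)]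
    simp only [hup]
    rw [← Finset.sum_mul, ← Finset.mul_prod_erase _ _ (Finset.mem_univ i)]
    have hi := h i (g i)
    split_ifs at hi ⊢ with h1
    · rw [h1, hφ] at hi ⊢
      linear_combination (-F * ∏ j ∈ Finset.univ.erase i, φ j (g j)) * hi
    · linear_combination (-F * ∏ j ∈ Finset.univ.erase i, φ j (g j)) * hi +
        (φ i (g i) * ∏ j ∈ Finset.univ.erase i, φ j (g j)) * hF
  set v : (∀ i, M i) → PowerSeries ℚ := fun g => ∏ i, φ i (g i)
  have hA : ∑ j, algebraMap ℚ (PowerSeries ℚ) (factorPencilConst M m g j) * v j =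
      (-1 + ∑ i, (m i : PowerSeries ℚ) * (1 - if g i = 1 then 1 else 0)) * v g := by
    simp [factorPencilConst, apply_ite (C : ℚ →+* PowerSeries ℚ)]
  have hB : ∑ j, algebraMap ℚ (PowerSeries ℚ) (factorPencilLetters T m ε g j) * v j =
      C ε * v g + ∑ i, (m i : PowerSeries ℚ) *
        ∑ s ∈ T i, v (Function.update g i (s⁻¹ * g i)) := by
    simp only [factorPencilLetters, Matrix.of_apply, map_add, map_sum, map_mul, add_mul,
      Finset.sum_add_distrib, Finset.sum_mul, apply_ite (algebraMap ℚ (PowerSeries ℚ)), map_one,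
      map_zero, map_natCast]
    congr 1
    · simp
    · rw [Finset.sum_comm]
      refine Finset.sum_congr rfl fun i _ => ?_
      simp only [mul_assoc, ← Finset.mul_sum, Finset.sum_mul]
      rw [Finset.sum_comm]
      simp
  rw [hA, hB, mul_add, Finset.mul_sum]
  have hsum : ∑ i, X * F * ((m i : PowerSeries ℚ) *
      ∑ s ∈ T i, v (Function.update g i (s⁻¹ * g i))) =
      (∑ i, (m i : PowerSeries ℚ) * (1 - if g i = 1 then 1 else 0)) * v g +
        F * (∑ i, (m i : PowerSeries ℚ) * V i) * v g := by
    rw [Finset.mul_sum, Finset.sum_mul, Finset.sum_mul, ← Finset.sum_add_distrib]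
    refine Finset.sum_congr rfl fun i _ => ?_
    rw [mul_left_comm, hstep]
    ring
  rw [hsum]
  linear_combination v g * hF - F * v g * hu

end FactorPencil

/-- Let `G₁,…,G_r` be finite groups with generating sets `S_i`.
Then the cogrowth series `F` of the free product `G₁^{⋆m₁} ⋆ ⋯ ⋆ G_r^{⋆m_r}` with
respect to the union `S` of the copies of the `S_i` is algebraic: there is a
nonzero `Λ ∈ ℚ[t,z]` with `Λ(t, F(t)) = 0` and both degrees at most
`(∏ |G_i|)(1 + ∑ 1/|G_i|)`; in particular the bound is independent of `m₁,…,m_r`. -/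
theorem cogrowth_free_product_algebraic_card_bound {r : ℕ} (Gi : Fin r → Type)
    [∀ i, Group (Gi i)] [∀ i, Finite (Gi i)]
    (Si : ∀ i, Set (Gi i)) (hgen : ∀ i, Subgroup.closure (Si i) = ⊤)
    (m : Fin r → ℕ) (hm : ∀ i, 0 < m i)
    (S : Set (Monoid.CoprodI (fun p : Σ i : Fin r, Fin (m i) => Gi p.1)))
    (hS : S = ⋃ p : Σ i : Fin r, Fin (m i),
      (Monoid.CoprodI.of (M := fun q : Σ i : Fin r, Fin (m i) => Gi q.1) (i := p)) '' (Si p.1))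
    (F : PowerSeries ℚ) (hF : F = cogrowthSeries S) :
    ∃ Λ : MvPolynomial (Fin 2) ℚ, Λ ≠ 0
      ∧ MvPolynomial.aeval ![PowerSeries.X, F] Λ = 0
      ∧ (MvPolynomial.degreeOf 0 Λ : ℚ)
          ≤ (∏ i, (Nat.card (Gi i) : ℚ)) * (1 + ∑ i, (Nat.card (Gi i) : ℚ)⁻¹)
      ∧ (MvPolynomial.degreeOf 1 Λ : ℚ)
          ≤ (∏ i, (Nat.card (Gi i) : ℚ)) * (1 + ∑ i, (Nat.card (Gi i) : ℚ)⁻¹) := by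
  classical
  have (i : Fin r) : Fintype (Gi i) := Fintype.ofFinite _
  have hfin : S.Finite := hS ▸ Set.finite_iUnion fun p => (Set.toFinite _).image _
  obtain ⟨S, rfl⟩ := hfin.exists_finset_coe
  let T : ∀ i, Finset (Gi i) := fun i => (Si i).toFinset.erase 1
  obtain ⟨u, V, φ, hφ, hu, hV⟩ := exists_factor_green T m (if 1 ∈ S then 1 else 0)
  have hS1 : S.erase 1 = (Finset.univ.sigma fun p : Σ i : Fin r, Fin (m i) => T p.1).image
      fun l => Monoid.CoprodI.of (M := fun q : Σ i : Fin r, Fin (m i) => Gi q.1) l.2 := by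
    ext x
    rw [Finset.mem_erase, ← Finset.mem_coe, hS]
    simp only [Set.mem_iUnion, Set.mem_image, Finset.mem_image, Finset.mem_sigma,
      Finset.mem_univ, true_and, T, Finset.mem_erase, Set.mem_toFinset]
    constructor
    · rintro ⟨h1, p, s, hs, rfl⟩
      exact ⟨⟨p, s⟩, ⟨fun (h : s = 1) => h1 (by rw [h, map_one]), hs⟩, rfl⟩
    · rintro ⟨⟨p, s⟩, ⟨h1, hs⟩, rfl⟩
      refine ⟨fun h => h1 ?_, p, s, hs, rfl⟩
      exact Monoid.CoprodI.of_injective p (h.trans (map_one _).symm)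
  have huF : u * F = 1 := by
    rw [hF]
    refine Monoid.CoprodI.mul_cogrowthSeries_eq_one S (fun p => T p.1) (fun p => by simp [T]) hS1
      (φ := fun p => φ p.1) (V := fun p => V p.1) (fun p => hφ p.1) ?_ fun p => hV p.1
    rw [hu, Fintype.sum_sigma]
    simp
  have hcard : (Fintype.card (∀ i, Gi i) : ℚ) ≤
      (∏ i, (Nat.card (Gi i) : ℚ)) * (1 + ∑ i, (Nat.card (Gi i) : ℚ)⁻¹) := by
    simp only [Fintype.card_pi, Nat.cast_prod, Nat.card_eq_fintype_card]
    exact le_mul_of_one_le_right (by positivity) (le_add_of_nonneg_right (by positivity))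
  have hdeg (k : Fin 2) := (Nat.cast_le (α := ℚ)).2 (Matrix.degreeOf_detPencil_le
    (factorPencilConst Gi m) (factorPencilLetters T m (if 1 ∈ S then 1 else 0)) k)
  exact ⟨_, Matrix.detPencil_ne_zero _ _, aeval_detPencil_factorPencil T m _ hφ hu hV huF,
    (hdeg 0).trans hcard, (hdeg 1).trans hcard⟩
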